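/- Let k ≥ 3 be odd, ⌊k/2⌋ + 1 ≤ r < k ≤ n, and write n = p(k-1) + q with 0 ≤ q ≤ k-2. Then the maximum number of edges of an n-vertex graph containing no K_r and no path on k vertices equals p·ex(k-1, K_r) + ex(q, K_r). -/

import Mathlib

open SimpleGraph

/-- `exK n r` is the Turán number ex(n, K_r): the maximum number of edges of an
`n`-vertex graph containing no copy of `K_r`. -/
noncomputable def exK (n r : ℕ) : ℕ :=
  sSup {m | ∃ G : SimpleGraph (Fin n), G.CliqueFree r ∧ G.edgeSet.ncard = m}

/-- A list is closed for `G` when its last entry is adjacent to its first one. -/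
def SimpleGraph.ListClosed {V : Type*} (G : SimpleGraph V) (l : List V) : Prop :=
  ∀ a ∈ l.getLast?, ∀ b ∈ l.head?, G.Adj a b

theorem List.IsChain.reverse_adj {V : Type*} {G : SimpleGraph V} {l : List V}
    (h : l.IsChain G.Adj) : l.reverse.IsChain G.Adj :=
  List.isChain_reverse.2 (h.imp fun _ _ h => h.symm)

theorem SimpleGraph.ListClosed.isChain_rotate {V : Type*} {G : SimpleGraph V} {l₁ l₂ : List V}
    {c : V} (hc : G.ListClosed (l₁ ++ c :: l₂)) (h : (l₁ ++ c :: l₂).IsChain G.Adj) :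
    (c :: l₂ ++ l₁).IsChain G.Adj := by
  rw [List.isChain_append] at h ⊢
  refine ⟨h.2.1, h.1, fun a ha b hb => hc a ?_ b ?_⟩
  · rw [List.getLast?_append, ha]; rfl
  · rw [List.head?_append, hb]; rfl

theorem SimpleGraph.exists_closed_of_crossing {W : Type*} [BEq W] [LawfulBEq W] (H : SimpleGraph W)
    {L : List W} (hL : L.IsChain H.Adj) (hn : L.Nodup) {x y : W} (hx : x ∈ L.head?)
    (hy : y ∈ L.getLast?) {S T : Finset W} (hS : ∀ a ∈ S, a ∈ L ∧ H.Adj x a)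
    (hT : ∀ b ∈ T, b ∈ L ∧ H.Adj y b) (hc : ∃ a ∈ S, ∃ b ∈ T, L.idxOf b < L.idxOf a) :
    ∃ l : List W, l.IsChain H.Adj ∧ l.Nodup ∧ H.ListClosed l ∧
      min L.length (S.card + T.card) ≤ l.length := by
  classical
  have hD : ∃ d, ∃ a ∈ S, ∃ b ∈ T, L.idxOf a = L.idxOf b + d + 1 := by
    obtain ⟨a, ha, b, hb, h⟩ := hc
    exact ⟨L.idxOf a - L.idxOf b - 1, a, ha, b, hb, by omega⟩
  obtain ⟨a, ha, b, hb, hab⟩ := Nat.find_spec hD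
  have hmin : ∀ a' ∈ S, ∀ b' ∈ T, L.idxOf b' < L.idxOf a' →
      Nat.find hD ≤ L.idxOf a' - L.idxOf b' - 1 := fun a' ha' b' hb' h =>
    Nat.find_min' hD ⟨a', ha', b', hb', by omega⟩
  set d := Nat.find hD
  obtain ⟨haL, hxa⟩ := hS a ha
  obtain ⟨hbL, hyb⟩ := hT b hb
  have hi := List.idxOf_lt_length_of_mem haL
  have hj := List.idxOf_lt_length_of_mem hbL
  have hgi : L[L.idxOf a] = a := List.getElem_idxOf hi
  have hgj : L[L.idxOf b] = b := List.getElem_idxOf hj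
  refine ⟨L.take (L.idxOf b + 1) ++ (L.drop (L.idxOf a)).reverse, ?_, ?_, ?_, ?_⟩
  · refine (hL.take _).append (hL.drop _).reverse_adj ?_
    intro u hu v hv
    have hu' : u = b := by
      rw [List.getLast?_take] at hu
      simpa [hgj, eq_comm, hbL] using hu
    have hv' : v = y := by
      rw [List.head?_reverse, List.getLast?_drop, if_neg (by omega)] at hv
      exact Option.mem_unique hv hy
    subst hu' hv'
    exact hyb.symm
  · rw [List.nodup_append]
    refine ⟨hn.sublist (List.take_sublist _ _), by
      simpa using hn.sublist (List.drop_sublist _ _), ?_⟩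
    intro u hu v hv huv
    subst huv
    rw [List.mem_reverse] at hv
    exact List.disjoint_take_drop hn (by omega) hu hv
  · intro u hu v hv
    have hu' : u = a := by
      rw [List.getLast?_append, List.getLast?_reverse, List.head?_drop] at hu
      simpa [hgi, eq_comm, hi] using hu
    have hv' : v = x := by
      rw [List.head?_append, List.head?_take, if_neg (by omega)] at hv
      rw [Option.mem_def] at hx
      simpa [hx, eq_comm] using hv
    subst hu' hv'
    exact hxa.symm
  · have hlen : (L.take (L.idxOf b + 1) ++ (L.drop (L.idxOf a)).reverse).length + d
        = L.length := by
      simp; omega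
    rcases Nat.eq_zero_or_pos d with h0 | hpos
    · omega
    have hcS : (S.image L.idxOf).card = S.card := Finset.card_image_of_injOn fun u hu v hv h =>
      (List.idxOf_inj (hS u hu).1).1 h
    have hcT : (T.image fun v => L.idxOf v + 1).card = T.card :=
      Finset.card_image_of_injOn fun u hu v hv h =>
        (List.idxOf_inj (hT u hu).1).1 (by simpa using h)
    have hdisj : Disjoint (S.image L.idxOf) (T.image fun v => L.idxOf v + 1) := by
      rw [Finset.disjoint_left]
      intro z hz hz'
      obtain ⟨u, hu, rfl⟩ := Finset.mem_image.1 hz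
      obtain ⟨v, hv, hvz⟩ := Finset.mem_image.1 hz'
      have := hmin u hu v hv (by omega)
      omega
    have hsub : S.image L.idxOf ∪ (T.image fun v => L.idxOf v + 1) ⊆
        (Finset.Ico 1 L.length) \ (Finset.Ioo (L.idxOf b + 1) (L.idxOf a)) := by
      intro z hz
      rw [Finset.mem_union, Finset.mem_image, Finset.mem_image] at hz
      rw [Finset.mem_sdiff, Finset.mem_Ico, Finset.mem_Ioo]
      rcases hz with ⟨u, hu, rfl⟩ | ⟨v, hv, rfl⟩
      · have h1 := List.idxOf_lt_length_of_mem (hS u hu).1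
        have h2 : L.idxOf u ≠ 0 := by
          intro h
          have h3 : L[L.idxOf u] = u := List.getElem_idxOf h1
          have h4 : L[0] = x := by
            rw [List.head?_eq_getElem?, Option.mem_def, List.getElem?_eq_some_iff] at hx
            exact hx.2
          simp only [h] at h3
          exact (hS u hu).2.ne (h4.symm.trans h3)
        refine ⟨⟨by omega, h1⟩, fun h => ?_⟩
        have := hmin u hu b hb (by omega)
        omega
      · have h1 := List.idxOf_lt_length_of_mem (hT v hv).1
        have h2 : L.idxOf v + 1 ≠ L.length := by
          intro h
          have h3 : L[L.idxOf v] = v := List.getElem_idxOf h1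
          have h4 : L[L.idxOf v] = y := by
            rw [List.getLast?_eq_getElem?, Option.mem_def, List.getElem?_eq_some_iff] at hy
            obtain ⟨h5, h6⟩ := hy
            rw [← h6]
            congr 1
            omega
          exact (hT v hv).2.ne (h4.symm.trans h3)
        refine ⟨⟨by omega, by omega⟩, fun h => ?_⟩
        have := hmin a ha v hv (by omega)
        omega
    have hcard := Finset.card_le_card hsub
    rw [Finset.card_union_of_disjoint hdisj, hcS, hcT, Finset.card_sdiff_of_subset (by
      intro z hz
      rw [Finset.mem_Ioo] at hz
      rw [Finset.mem_Ico]
      omega), Nat.card_Ico, Nat.card_Ioo] at hcard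
    omega

/-- The graph obtained from `G` by adding a vertex `none` adjacent to all vertices of `G`. -/
def SimpleGraph.apex {V : Type*} (G : SimpleGraph V) : SimpleGraph (Option V) where
  Adj a b := match a, b with
    | some u, some v => G.Adj u v
    | none, none => False
    | _, _ => True
  symm := ⟨by
    rintro (_ | u) (_ | v) h
    · exact h
    · trivial
    · trivial
    · exact SimpleGraph.Adj.symm (G := G) h⟩
  loopless := ⟨by
    rintro (_ | u) h
    · exact h
    · exact G.loopless.irrefl u h⟩

theorem SimpleGraph.exists_map_some_of_none_notMem {V : Type*} {G : SimpleGraph V}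
    {l : List (Option V)} (hl : l.IsChain G.apex.Adj) (hn : l.Nodup) (h0 : none ∉ l) :
    ∃ l' : List V, l'.IsChain G.Adj ∧ l'.Nodup ∧ l'.length = l.length := by
  have h : ∃ l' : List V, l = l'.map some := by
    clear hl hn
    induction l with
    | nil => exact ⟨[], rfl⟩
    | cons a l ih =>
      rw [List.mem_cons, not_or] at h0
      obtain ⟨l', rfl⟩ := ih h0.2
      cases a with
      | none => exact absurd rfl h0.1
      | some a => exact ⟨a :: l', rfl⟩
  obtain ⟨l', rfl⟩ := h
  rw [List.isChain_map] at hl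
  exact ⟨l', hl, List.Nodup.of_map _ hn, by simp⟩

theorem SimpleGraph.length_le_of_listClosed_apex {V : Type*} {G : SimpleGraph V} {M : ℕ}
    (hM : ∀ l : List V, l.IsChain G.Adj → l.Nodup → l.length ≤ M) {l : List (Option V)}
    (hl : l.IsChain G.apex.Adj) (hn : l.Nodup) (hc : G.apex.ListClosed l) :
    l.length ≤ M + 1 := by
  by_cases h0 : none ∈ l
  · obtain ⟨l₁, l₂, rfl⟩ := List.append_of_mem h0
    have h1 := hc.isChain_rotate hl
    have hn' : (none :: l₂ ++ l₁).Nodup := by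
      rw [List.nodup_append_comm]; exact hn
    rw [List.cons_append, List.nodup_cons] at hn'
    obtain ⟨l', h2, h3, h4⟩ := exists_map_some_of_none_notMem
      (List.IsChain.tail h1) hn'.2 hn'.1
    have := hM l' h2 h3
    simp at h4 ⊢
    omega
  · obtain ⟨l', h2, h3, h4⟩ := exists_map_some_of_none_notMem hl hn h0
    have := hM l' h2 h3
    omega

/-- A path list together with `k` neighbours of its head on it contains a closed initial segment
of length at least `k + 1`. -/
theorem SimpleGraph.exists_closed_prefix {V : Type*} [DecidableEq V] {G : SimpleGraph V} {x : V}
    {A : List V} {S : Finset V} (hA : (x :: A).IsChain G.Adj)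
    (hS : ∀ a ∈ S, a ∈ A ∧ G.Adj x a) (h1 : 1 ≤ S.card) :
    ∃ C : List V, C <+: x :: A ∧ G.ListClosed C ∧ S.card + 1 ≤ C.length := by
  induction A using List.reverseRecOn with
  | nil =>
    obtain ⟨a, ha⟩ := Finset.card_pos.1 h1
    simpa using (hS a ha).1
  | append_singleton A v ih =>
    by_cases hv : v ∈ S
    · refine ⟨_, List.prefix_rfl, ?_, ?_⟩
      · intro a ha b hb
        have h2 : a = v := by
          rw [← List.cons_append, List.getLast?_append] at ha
          simpa [eq_comm] using ha
        have h3 : b = x := by simpa [eq_comm] using hb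
        subst h2 h3
        exact (hS _ hv).2.symm
      · have : S ⊆ (A ++ [v]).toFinset := fun a ha => by simpa [or_comm] using (hS a ha).1
        have h2 := (Finset.card_le_card this).trans (List.toFinset_card_le _)
        rw [List.length_cons]
        omega
    · rw [← List.cons_append] at hA
      obtain ⟨C, hC, h2, h3⟩ := ih hA.left_of_append fun a ha => ⟨by
        have := (hS a ha).1
        rw [List.mem_append, List.mem_singleton] at this
        exact this.resolve_right fun h => hv (h ▸ ha), (hS a ha).2⟩
      exact ⟨C, hC.trans (List.prefix_append (x :: A) [v]), h2, h3⟩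

theorem SimpleGraph.Connected.exists_path_list_between {V : Type*} {G : SimpleGraph V}
    (hG : G.Connected) {S T : Set V} (hST : Disjoint S T) (hS : S.Nonempty) (hT : T.Nonempty) :
    ∃ u ∈ S, ∃ v ∈ T, ∃ l : List V, (u :: (l ++ [v])).IsChain G.Adj ∧ (u :: (l ++ [v])).Nodup ∧
      ∀ z ∈ l, z ∉ S ∧ z ∉ T := by
  classical
  have hex : ∃ n, ∃ u ∈ S, ∃ v ∈ T, ∃ w : G.Walk u v, w.length = n := by
    obtain ⟨u, hu⟩ := hS
    obtain ⟨v, hv⟩ := hT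
    obtain ⟨w⟩ := hG.preconnected u v
    exact ⟨_, u, hu, v, hv, w, rfl⟩
  obtain ⟨u, hu, v, hv, w, hw⟩ := Nat.find_spec hex
  have hmin : ∀ u' ∈ S, ∀ v' ∈ T, ∀ w' : G.Walk u' v', w.length ≤ w'.length := by
    intro u' hu' v' hv' w'
    rw [hw]
    exact Nat.find_min' hex ⟨u', hu', v', hv', w', rfl⟩
  have huv : u ≠ v := fun h => Set.disjoint_left.1 hST hu (h ▸ hv)
  have hp : w.IsPath := by
    have h1 := w.bypass_isPath
    have h2 := hmin u hu v hv w.bypass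
    rwa [w.bypass_eq_self_of_length_le_length_bypass h2] at h1
  have hSz : ∀ z ∈ w.support, z ∈ S → z = u := by
    intro z hz hzS
    by_contra hne
    have := Walk.length_dropUntil_lt_length hz hne
    have := hmin z hzS v hv (w.dropUntil z hz)
    omega
  have hTz : ∀ z ∈ w.support, z ∈ T → z = v := by
    intro z hz hzT
    by_contra hne
    have := Walk.length_takeUntil_lt_length hz hne
    have := hmin u hu z hzT (w.takeUntil z hz)
    omega
  cases w with
  | nil => exact absurd rfl huv
  | @cons _ a _ h w' =>
    obtain ⟨l, hl⟩ : ∃ l, w'.support = l ++ [v] := by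
      refine ⟨w'.support.dropLast, ?_⟩
      conv_lhs => rw [← List.dropLast_append_getLast w'.support_ne_nil]
      rw [w'.getLast_support]
    have hs : (Walk.cons h w').support = u :: (l ++ [v]) := by rw [Walk.support_cons, hl]
    have hnd := hp.support_nodup
    rw [hs] at hnd
    refine ⟨u, hu, v, hv, l, hs ▸ Walk.isChain_adj_support _, hnd, ?_⟩
    intro z hz
    have hz' : z ∈ (Walk.cons h w').support := by rw [hs]; simp [hz]
    rw [List.nodup_cons] at hnd
    refine ⟨fun h1 => ?_, fun h1 => ?_⟩
    · have := hSz z hz' h1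
      subst this
      exact hnd.1 (by simp [hz])
    · have := hTz z hz' h1
      subst this
      exact (List.nodup_append.1 hnd.2).2.2 z hz z (by simp) rfl

theorem SimpleGraph.exists_rotate_head {V : Type*} {G : SimpleGraph V} {C : List V}
    (hC : C.IsChain G.Adj) (hc : G.ListClosed C) {c : V} (h : c ∈ C) :
    ∃ l, (c :: l).IsChain G.Adj ∧ (c :: l).Perm C := by
  obtain ⟨l₁, l₂, rfl⟩ := List.append_of_mem h
  exact ⟨l₂ ++ l₁, hc.isChain_rotate hC, List.perm_append_comm (l₁ := c :: l₂)⟩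

/-- Two disjoint closed lists in a connected graph lie on a common path. -/
theorem SimpleGraph.Connected.exists_path_of_closed {V : Type*} {G : SimpleGraph V}
    (hG : G.Connected) {C D : List V} (hC : C.IsChain G.Adj) (hD : D.IsChain G.Adj)
    (hcC : G.ListClosed C) (hcD : G.ListClosed D) (hn : (C ++ D).Nodup) (hC0 : C ≠ [])
    (hD0 : D ≠ []) :
    ∃ l : List V, l.IsChain G.Adj ∧ l.Nodup ∧ C.length + D.length ≤ l.length := by
  rw [List.nodup_append] at hn
  obtain ⟨u, hu, v, hv, l, hl, hln, hz⟩ := hG.exists_path_list_between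
    (S := {z | z ∈ C}) (T := {z | z ∈ D})
    (Set.disjoint_left.2 fun a h1 h2 => hn.2.2 a h1 a h2 rfl)
    (List.exists_mem_of_ne_nil _ hC0) (List.exists_mem_of_ne_nil _ hD0)
  obtain ⟨C', hC1, hC2⟩ := exists_rotate_head hC hcC hu
  obtain ⟨D', hD1, hD2⟩ := exists_rotate_head hD hcD hv
  refine ⟨(u :: C').reverse ++ (l ++ (v :: D')), ?_, ?_, ?_⟩
  · rw [List.reverse_cons, List.append_assoc, List.singleton_append, List.isChain_split]
    refine ⟨by simpa using hC1.reverse_adj, ?_⟩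
    rw [← List.cons_append, List.isChain_split]
    exact ⟨by simpa using hl, hD1⟩
  · rw [List.nodup_append, List.nodup_append]
    rw [List.nodup_cons, List.nodup_append] at hln
    refine ⟨by rw [List.nodup_reverse]; exact hC2.nodup_iff.2 hn.1,
      ⟨hln.2.1, hD2.nodup_iff.2 hn.2.1, ?_⟩, ?_⟩
    · intro a ha b hb hab
      exact (hz a ha).2 (hD2.mem_iff.1 (hab ▸ hb))
    · intro a ha b hb hab
      rw [List.mem_reverse, hC2.mem_iff] at ha
      subst hab
      rcases List.mem_append.1 hb with h | h
      · exact (hz a h).1 ha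
      · exact hn.2.2 a ha a (hD2.mem_iff.1 h) rfl
  · have := hC2.length_eq
    have := hD2.length_eq
    simp only [List.length_append, List.length_reverse]
    omega

/-- In a connected graph, two disjoint paths whose starting vertices have many neighbours on the
paths can be recombined to a long path. -/
theorem SimpleGraph.Connected.lt_of_two_paths {V : Type*} {G : SimpleGraph V} (hG : G.Connected)
    {M : ℕ} (hM : ∀ l : List V, l.IsChain G.Adj → l.Nodup → l.length ≤ M) {x y : V}
    {A B : List V} (hA : (x :: A).IsChain G.Adj) (hB : (y :: B).IsChain G.Adj)
    (hn : ((x :: A) ++ (y :: B)).Nodup) (hlen : M < ((x :: A) ++ (y :: B)).length)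
    {S T : Finset V} (hS : ∀ a ∈ S, a ∈ (x :: A) ++ (y :: B) ∧ G.Adj x a)
    (hT : ∀ a ∈ T, a ∈ (x :: A) ++ (y :: B) ∧ G.Adj y a) (hS1 : 1 ≤ S.card) (hT1 : 1 ≤ T.card) :
    S.card + T.card < M := by
  classical
  by_contra! hST
  by_cases hcr : (∃ a ∈ S, a ∈ y :: B) ∨ (∃ b ∈ T, b ∈ x :: A)
  · set L : List (Option V) := (x :: A).map some ++ none :: ((y :: B).map some).reverse with hL
    have hnone : none ∉ (x :: A).map some := by simp
    have hidx : L.idxOf none = (x :: A).length := by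
      rw [hL, List.idxOf_append_of_notMem hnone]; simp
    have hidA : ∀ v ∈ x :: A, L.idxOf (some v) < (x :: A).length := by
      intro v hv
      have hv' : some v ∈ (x :: A).map some := List.mem_map_of_mem hv
      rw [hL, List.idxOf_append_of_mem hv']
      simpa using List.idxOf_lt_length_of_mem hv'
    have hidB : ∀ v ∈ y :: B, (x :: A).length < L.idxOf (some v) := by
      intro v hv
      have hv' : some v ∉ (x :: A).map some := by
        rw [List.mem_map_of_injective (Option.some_injective V)]
        exact fun h => (List.nodup_append.1 hn).2.2 v h v hv rfl
      rw [hL, List.idxOf_append_of_notMem hv', List.idxOf_cons_ne _ (by simp)]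
      simp
    obtain ⟨l, h1, h2, h3, h4⟩ := exists_closed_of_crossing G.apex (L := L) (x := some x)
      (y := some y) (S := insert none (S.map Function.Embedding.some))
      (T := insert none (T.map Function.Embedding.some)) (by
        rw [hL, List.isChain_append]
        refine ⟨(List.isChain_map some).2 hA, ?_, ?_⟩
        · refine List.IsChain.cons ?_ ?_
          · exact List.IsChain.reverse_adj ((List.isChain_map some).2 hB)
          · intro b hb
            rw [List.head?_reverse] at hb
            obtain ⟨c, -, rfl⟩ := List.mem_map.1 (List.mem_of_getLast? hb)
            trivial
        · intro a ha b hb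
          obtain ⟨c, -, rfl⟩ := List.mem_map.1 (List.mem_of_getLast? ha)
          have : b = none := by simpa [eq_comm] using hb
          subst this
          trivial) (by
        have h := hn.map (Option.some_injective V)
        rw [List.map_append] at h
        rw [hL, List.nodup_middle, List.nodup_cons]
        refine ⟨by simp, ?_⟩
        exact ((List.Perm.append_left _ (List.reverse_perm _)).nodup_iff).2 h)
      (by simp [hL]) (by simp [hL, List.getLast?_cons]) (by
        intro a ha
        rcases Finset.mem_insert.1 ha with rfl | ha
        · exact ⟨by simp [hL], trivial⟩
        · obtain ⟨c, hc, rfl⟩ := Finset.mem_map.1 ha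
          refine ⟨?_, (hS c hc).2⟩
          have := (hS c hc).1
          simp [hL] at this ⊢
          tauto) (by
        intro a ha
        rcases Finset.mem_insert.1 ha with rfl | ha
        · exact ⟨by simp [hL], trivial⟩
        · obtain ⟨c, hc, rfl⟩ := Finset.mem_map.1 ha
          refine ⟨?_, (hT c hc).2⟩
          have := (hT c hc).1
          simp [hL] at this ⊢
          tauto) (by
        rcases hcr with ⟨a, ha, haB⟩ | ⟨b, hb, hbA⟩
        · exact ⟨some a, by simpa using ha, none, by simp, by rw [hidx]; exact hidB a haB⟩
        · exact ⟨none, by simp, some b, by simpa using hb, by rw [hidx]; exact hidA b hbA⟩)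
    have h5 := length_le_of_listClosed_apex hM h1 h2 h3
    rw [Finset.card_insert_of_notMem (by simp), Finset.card_insert_of_notMem (by simp),
      Finset.card_map, Finset.card_map] at h4
    have h6 : L.length = ((x :: A) ++ (y :: B)).length + 1 := by
      simp [hL]; omega
    omega
  · push Not at hcr
    have hn' := List.nodup_append.1 hn
    obtain ⟨C, hC, hC1, hC2⟩ := exists_closed_prefix hA (S := S) (fun a ha => by
      obtain ⟨h1, h2⟩ := hS a ha
      have h3 := (List.mem_append.1 h1).resolve_right (hcr.1 a ha)
      exact ⟨(List.mem_cons.1 h3).resolve_left h2.ne', h2⟩) hS1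
    obtain ⟨D, hD, hD1, hD2⟩ := exists_closed_prefix hB (S := T) (fun a ha => by
      obtain ⟨h1, h2⟩ := hT a ha
      have h3 := (List.mem_append.1 h1).resolve_left (hcr.2 a ha)
      exact ⟨(List.mem_cons.1 h3).resolve_left h2.ne', h2⟩) hT1
    obtain ⟨l, h1, h2, h3⟩ := hG.exists_path_of_closed (hA.prefix hC) (hB.prefix hD) hC1 hD1
      (hn.sublist (hC.sublist.append hD.sublist))
      (by rintro rfl; simp at hC2) (by rintro rfl; simp at hD2)
    have := hM l h1 h2
    omega

theorem SimpleGraph.exists_two_paths_of_sup_edge {V : Type*} {G : SimpleGraph V} {x y : V}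
    {l : List V} (hl : l.IsChain (G ⊔ edge x y).Adj) (hn : l.Nodup) (hG : ¬ l.IsChain G.Adj) :
    ∃ A B : List V, (x :: A).IsChain G.Adj ∧ (y :: B).IsChain G.Adj ∧
      ((x :: A) ++ (y :: B)).Nodup ∧ ((x :: A) ++ (y :: B)).length = l.length := by
  obtain ⟨n, hn1, hn2⟩ := List.exists_not_getElem_of_not_isChain hG
  have hedge : ∀ a b, (G ⊔ edge x y).Adj a b → ¬ G.Adj a b →
      (a = x ∧ b = y) ∨ (a = y ∧ b = x) := by
    intro a b h h'
    rw [sup_adj, edge_adj] at h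
    tauto
  have hxy := hedge _ _ (List.isChain_iff_getElem.1 hl n hn1) hn2
  have hdisj := List.disjoint_take_drop hn (le_refl (n + 1))
  have hmemT : l[n] ∈ l.take (n + 1) := List.mem_take_iff_getElem.2 ⟨n, by omega, rfl⟩
  have hmemD : l[n + 1] ∈ l.drop (n + 1) := List.mem_drop_iff_getElem.2 ⟨0, by simpa, by simp⟩
  have hT : (l.take (n + 1)).IsChain G.Adj := by
    refine (hl.take (n + 1)).imp_of_mem_imp fun a b ha hb hab => ?_
    by_contra h
    have := hdisj (a := l[n + 1])
    rcases hedge a b hab h with ⟨rfl, rfl⟩ | ⟨rfl, rfl⟩ <;> rcases hxy with ⟨h1, h2⟩ | ⟨h1, h2⟩ <;>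
      simp_all
  have hD : (l.drop (n + 1)).IsChain G.Adj := by
    refine (hl.drop (n + 1)).imp_of_mem_imp fun a b ha hb hab => ?_
    by_contra h
    have := hdisj (a := l[n])
    rcases hedge a b hab h with ⟨rfl, rfl⟩ | ⟨rfl, rfl⟩ <;> rcases hxy with ⟨h1, h2⟩ | ⟨h1, h2⟩ <;>
      simp_all
  have hsplitD : l.drop (n + 1) = l[n + 1] :: l.drop (n + 2) := List.drop_eq_getElem_cons hn1
  have hsplitT : (l.take (n + 1)).reverse = l[n] :: (l.take n).reverse := by
    rw [List.take_succ_eq_append_getElem (by omega), List.reverse_append]; rfl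
  have hT' := hT.reverse_adj
  rw [hsplitT] at hT'
  rw [hsplitD] at hD
  have hperm : ((l[n] :: (l.take n).reverse) ++ (l[n + 1] :: l.drop (n + 2))).Perm l := by
    rw [← hsplitT, ← hsplitD]
    conv_rhs => rw [← List.take_append_drop (n + 1) l]
    exact (List.reverse_perm _).append_right _
  rcases hxy with ⟨h1, h2⟩ | ⟨h1, h2⟩
  · rw [h1] at hperm hT'
    rw [h2] at hperm hD
    exact ⟨_, _, hT', hD, hperm.nodup_iff.2 hn, hperm.length_eq⟩
  · rw [h1] at hperm hT'
    rw [h2] at hperm hD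
    have hperm' := List.perm_append_comm.trans hperm
    exact ⟨_, _, hD, hT', hperm'.nodup_iff.2 hn, hperm'.length_eq⟩

/-- All paths of `G` have at most `M` vertices. -/
def SimpleGraph.PathBounded {V : Type*} (M : ℕ) (G : SimpleGraph V) : Prop :=
  ∀ l : List V, l.IsChain G.Adj → l.Nodup → l.length ≤ M

open Classical in
/-- Kopylov's adjacency argument: in an edge-maximal connected graph without long paths, two sets
of sufficiently large internal minimum degrees are completely joined. -/
theorem SimpleGraph.adj_of_maximal_pathBounded {V : Type*} [Fintype V] {G : SimpleGraph V} {M : ℕ}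
    (hG : G.Connected) (hmax : Maximal (PathBounded M) G) {X Y : Finset V} {α β : ℕ} (hα : 1 ≤ α)
    (hβ : 1 ≤ β) (hαβ : M ≤ α + β) (hX : ∀ x ∈ X, α ≤ (X.filter (G.Adj x)).card)
    (hY : ∀ y ∈ Y, β ≤ (Y.filter (G.Adj y)).card) {x y : V} (hx : x ∈ X) (hy : y ∈ Y)
    (hxy : x ≠ y) : G.Adj x y := by
  by_contra hnadj
  let Q : Set ℕ := {N | ∃ x ∈ X, ∃ y ∈ Y, x ≠ y ∧ ¬ G.Adj x y ∧ ∃ A B : List V,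
    (x :: A).IsChain G.Adj ∧ (y :: B).IsChain G.Adj ∧ ((x :: A) ++ (y :: B)).Nodup ∧
    ((x :: A) ++ (y :: B)).length = N ∧ M < N}
  have hQ : Q.Nonempty := by
    have h1 : ¬ PathBounded M (G ⊔ edge x y) := fun h => by
      have := hmax.2 h le_sup_left
      exact hnadj (this (by rw [sup_adj, edge_adj]; tauto))
    unfold PathBounded at h1
    push Not at h1
    obtain ⟨l, h2, h3, h4⟩ := h1
    obtain ⟨A, B, h5, h6, h7, h8⟩ := exists_two_paths_of_sup_edge h2 h3 fun h => by
      have := hmax.1 l h h3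
      omega
    exact ⟨_, x, hx, y, hy, hxy, hnadj, A, B, h5, h6, h7, h8, h4⟩
  have hb : BddAbove Q := by
    refine ⟨Fintype.card V, ?_⟩
    rintro N ⟨x, -, y, -, -, -, A, B, -, -, h, rfl, -⟩
    exact h.length_le_card
  obtain ⟨x, hx, y, hy, hxy, hnadj, A, B, hA, hB, hn, hN, hMN⟩ := Nat.sSup_mem hQ hb
  have hlt : ∀ N ∈ Q, N ≤ sSup Q := fun N hN => le_csSup hb hN
  rw [← hN] at hlt hMN
  have hn' := List.nodup_append.1 hn
  have key : (X.filter (G.Adj x)).card + (Y.filter (G.Adj y)).card < M := by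
    refine hG.lt_of_two_paths hmax.1 hA hB hn hMN ?_ ?_ (hα.trans (hX x hx)) (hβ.trans (hY y hy))
    · intro a ha
      obtain ⟨haX, hxa⟩ := Finset.mem_filter.1 ha
      refine ⟨?_, hxa⟩
      by_contra hmem
      have hA' : (a :: x :: A).IsChain G.Adj := List.isChain_cons_cons.2 ⟨hxa.symm, hA⟩
      have hnd : ((a :: x :: A) ++ (y :: B)).Nodup := List.nodup_cons.2 ⟨hmem, hn⟩
      have hay : a ≠ y := fun h => hmem (by simp [h])
      by_cases hadj : G.Adj a y
      · have := hmax.1 ((a :: x :: A).reverse ++ (y :: B)) (hA'.reverse_adj.append hB (by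
          simp; exact hadj)) (((List.reverse_perm _).append_right _).nodup_iff.2 hnd)
        simp at this hMN
        omega
      · have := hlt _ ⟨a, haX, y, hy, hay, hadj, _, _, hA', hB, hnd, rfl, by simp at hMN ⊢; omega⟩
        simp at this
    · intro a ha
      obtain ⟨haY, hya⟩ := Finset.mem_filter.1 ha
      refine ⟨?_, hya⟩
      by_contra hmem
      have hB' : (a :: y :: B).IsChain G.Adj := List.isChain_cons_cons.2 ⟨hya.symm, hB⟩
      have hnd : ((x :: A) ++ (a :: y :: B)).Nodup := by
        rw [List.nodup_middle]; exact List.nodup_cons.2 ⟨hmem, hn⟩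
      have hax : x ≠ a := fun h => hmem (by simp [h])
      by_cases hadj : G.Adj x a
      · have := hmax.1 ((x :: A).reverse ++ (a :: y :: B)) (hA.reverse_adj.append hB' (by
          simp; exact hadj)) (((List.reverse_perm _).append_right _).nodup_iff.2 hnd)
        simp at this hMN
        omega
      · have := hlt _ ⟨x, hx, a, haY, hax, hadj, _, _, hA, hB', hnd, rfl, by simp at hMN ⊢; omega⟩
        simp at this
  have := hX x hx
  have := hY y hy
  omega

open Classical in
/-- Kopylov's core theorem for paths: some core of a connected graph without paths on
`2 * m + 1` vertices is small. -/
theorem SimpleGraph.Connected.exists_core_card_le {V : Type*} [Fintype V] {G : SimpleGraph V}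
    (hG : G.Connected) {m : ℕ} (hm : 1 ≤ m) (hP : PathBounded (2 * m) G) :
    ∃ i, i + 1 ≤ m ∧ ∀ S : Finset V, (∀ v ∈ S, i + 1 ≤ (S.filter (G.Adj v)).card) →
      S.card + i ≤ 2 * m := by
  obtain ⟨G', hGG', hmax⟩ := Finite.exists_le_maximal hP
  have hG' : G'.Connected := hG.mono hGG'
  have hmono : ∀ (S : Finset V) v, (S.filter (G.Adj v)).card ≤ (S.filter (G'.Adj v)).card :=
    fun S v => Finset.card_le_card fun a ha => by
      rw [Finset.mem_filter] at ha ⊢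
      exact ⟨ha.1, hGG' ha.2⟩
  let F : Finset (Finset V) := Finset.univ.filter fun S => ∀ v ∈ S, m ≤ (S.filter (G'.Adj v)).card
  obtain ⟨C, hCF, hCmax⟩ := F.exists_max_image Finset.card ⟨∅, by simp [F]⟩
  have hC : ∀ v ∈ C, m ≤ (C.filter (G'.Adj v)).card := (Finset.mem_filter.1 hCF).2
  have hmem : ∀ S : Finset V, (∀ v ∈ S, m ≤ (S.filter (G'.Adj v)).card) → S.card ≤ C.card :=
    fun S hS => hCmax S (Finset.mem_filter.2 ⟨Finset.mem_univ _, hS⟩)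
  by_cases hsmall : C.card ≤ m
  · refine ⟨m - 1, by omega, fun S hS => ?_⟩
    have := hmem S fun v hv => by
      have := hS v hv
      have := hmono S v
      omega
    omega
  · have hclique : ∀ x ∈ C, ∀ y ∈ C, x ≠ y → G'.Adj x y := fun x hx y hy hxy =>
      adj_of_maximal_pathBounded hG' hmax hm hm (by omega) hC hC hx hy hxy
    have hdeg : ∀ x ∈ C, C.card - 1 ≤ (C.filter (G'.Adj x)).card := fun x hx => by
      rw [← Finset.card_erase_of_mem hx]
      refine Finset.card_le_card fun y hy => ?_
      rw [Finset.mem_erase] at hy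
      exact Finset.mem_filter.2 ⟨hy.2, hclique x hx y hy.2 hy.1.symm⟩
    have hle : C.card ≤ 2 * m := by
      have h1 : C.toList.Pairwise G'.Adj := by
        refine C.nodup_toList.imp_of_mem fun ha hb hab => ?_
        exact hclique _ (Finset.mem_toList.1 ha) _ (Finset.mem_toList.1 hb) hab
      have := hmax.1 C.toList h1.isChain C.nodup_toList
      rwa [Finset.length_toList] at this
    refine ⟨2 * m - C.card, by omega, fun S hS => ?_⟩
    have hSC : S ⊆ C := by
      intro y hy
      by_contra hyC
      have hadj : ∀ x ∈ C, G'.Adj x y := fun x hx =>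
        adj_of_maximal_pathBounded hG' hmax (α := C.card - 1) (β := 2 * m - C.card + 1) (by omega)
          (by omega) (by omega) hdeg (fun v hv => (hS v hv).trans (hmono S v)) hx hy
          (fun h => hyC (h ▸ hx))
      have := hmem (insert y C) fun v hv => by
        rcases Finset.mem_insert.1 hv with rfl | hv
        · have : C ⊆ (insert v C).filter (G'.Adj v) := fun x hx => Finset.mem_filter.2
            ⟨Finset.mem_insert_of_mem hx, (hadj x hx).symm⟩
          have := Finset.card_le_card this
          omega
        · exact (hC v hv).trans (Finset.card_le_card (Finset.filter_subset_filter _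
            (Finset.subset_insert _ _)))
      rw [Finset.card_insert_of_notMem hyC] at this
      omega
    have := Finset.card_le_card hSC
    omega

/-- The number of edges of the Turán graph `T(j, r)` when `j ≤ 2 * r`. -/
def smallTuran (r j : ℕ) : ℕ := j * (j - 1) / 2 - (j - r)

/-- The number of edges of the disjoint union of `n / (2 * m)` copies of `T(2 * m, r)` and one
copy of `T(n % (2 * m), r)`. -/
def blockTuran (m r n : ℕ) : ℕ :=
  n / (2 * m) * smallTuran r (2 * m) + smallTuran r (n % (2 * m))

theorem two_mul_smallTuran {r j : ℕ} (hj : j ≤ 2 * r) :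
    2 * smallTuran r j + 2 * (j - r) = j * (j - 1) := by
  have h1 := Nat.div_mul_cancel (Nat.even_mul_pred_self j).two_dvd
  have h2 : 2 * (j - r) ≤ j * (j - 1) := by
    rcases Nat.lt_or_ge j 2 with h | h
    · interval_cases j <;> omega
    · calc 2 * (j - r) ≤ j * 1 := by omega
        _ ≤ j * (j - 1) := Nat.mul_le_mul_left _ (by omega)
  unfold smallTuran
  omega

theorem two_mul_smallTuran_cases {r j : ℕ} (hj : j ≤ 2 * r) :
    ((j : ℤ) ≤ r ∧ 2 * (smallTuran r j : ℤ) = j * (j - 1)) ∨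
      ((r : ℤ) < j ∧ 2 * (smallTuran r j : ℤ) = j * (j - 1) - 2 * (j - r)) := by
  have h := two_mul_smallTuran hj
  have h' : ((j * (j - 1) : ℕ) : ℤ) = j * (j - 1) := by
    rcases j with _ | j <;> simp
  rcases Nat.lt_or_ge r j with h1 | h1
  · right
    refine ⟨by exact_mod_cast h1, ?_⟩
    rw [← h', ← h]
    push_cast [Nat.cast_sub h1.le]
    ring
  · left
    refine ⟨by exact_mod_cast h1, ?_⟩
    rw [← h', ← h, Nat.sub_eq_zero_of_le h1]
    push_cast
    ring

theorem smallTuran_add_le {r a b : ℕ} (hr : 1 ≤ r) (hab : a + b ≤ 2 * r) :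
    smallTuran r a + smallTuran r b ≤ smallTuran r (a + b) := by
  rcases Nat.eq_zero_or_pos a with rfl | ha
  · simp [smallTuran]
  rcases Nat.eq_zero_or_pos b with rfl | hb
  · simp [smallTuran]
  have h1 := two_mul_smallTuran_cases (r := r) (j := a) (by omega)
  have h2 := two_mul_smallTuran_cases (r := r) (j := b) (by omega)
  have h3 := two_mul_smallTuran_cases hab
  push_cast at h3
  zify at *
  have h4 : (0 : ℤ) ≤ (a - 1) * (b - 1) := mul_nonneg (by linarith) (by linarith)
  rcases h1 with ⟨h1, h1'⟩ | ⟨h1, h1'⟩ <;> rcases h2 with ⟨h2, h2'⟩ | ⟨h2, h2'⟩ <;>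
    rcases h3 with ⟨h3, h3'⟩ | ⟨h3, h3'⟩ <;> nlinarith

theorem smallTuran_add_le_of_le_add {r N a b : ℕ} (hN : N ≤ 2 * r) (hrN : r < N) (ha : a < N)
    (hb : b < N) (hab : N ≤ a + b) :
    smallTuran r a + smallTuran r b ≤ smallTuran r N + smallTuran r (a + b - N) := by
  have h1 := two_mul_smallTuran_cases (r := r) (j := a) (by omega)
  have h2 := two_mul_smallTuran_cases (r := r) (j := b) (by omega)
  have h3 := two_mul_smallTuran_cases hN
  have h5 := two_mul_smallTuran_cases (r := r) (j := a + b - N) (by omega)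
  rw [Nat.cast_sub hab] at h5
  push_cast at h5
  zify at hN hrN ha hb hab ⊢
  have h4 : (0 : ℤ) ≤ (N - a - 1) * (N - b - 1) := mul_nonneg (by linarith) (by linarith)
  rcases h1 with ⟨h1, h1'⟩ | ⟨h1, h1'⟩ <;> rcases h2 with ⟨h2, h2'⟩ | ⟨h2, h2'⟩ <;>
    rcases h3 with ⟨h3, h3'⟩ | ⟨h3, h3'⟩ <;> rcases h5 with ⟨h5, h5'⟩ | ⟨h5, h5'⟩ <;> nlinarith

theorem blockTuran_eq_smallTuran {m r n : ℕ} (hm : 1 ≤ m) (hn : n ≤ 2 * m) :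
    blockTuran m r n = smallTuran r n := by
  rcases hn.lt_or_eq with h | rfl
  · rw [blockTuran, Nat.div_eq_of_lt h, Nat.mod_eq_of_lt h]; simp
  · rw [blockTuran, Nat.div_self (by omega), Nat.mod_self]; simp [smallTuran]

theorem blockTuran_add_le {m r : ℕ} (hmr : m ≤ r) (hrm : r < 2 * m) (a b : ℕ) :
    blockTuran m r a + blockTuran m r b ≤ blockTuran m r (a + b) := by
  have hm : 0 < 2 * m := by omega
  have h1 := Nat.mod_lt a hm
  have h2 := Nat.mod_lt b hm
  unfold blockTuran
  rw [Nat.add_div hm, Nat.add_mod]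
  split_ifs with h
  · have h3 := smallTuran_add_le_of_le_add (r := r) (by omega) hrm h1 h2 h
    have hmod : (a % (2 * m) + b % (2 * m)) % (2 * m) = a % (2 * m) + b % (2 * m) - 2 * m := by
      rw [Nat.mod_eq_sub_mod h]
      exact Nat.mod_eq_of_lt (by omega)
    rw [hmod]
    nlinarith
  · have h3 := smallTuran_add_le (r := r) (a := a % (2 * m)) (b := b % (2 * m))
      (by omega) (by omega)
    rw [Nat.mod_eq_of_lt (a := a % (2 * m) + b % (2 * m)) (by omega)]
    nlinarith

theorem smallTuran_add_mul_le {m r i q : ℕ} (hmr : m ≤ r) (hrm : r < 2 * m) (hi : i + 1 ≤ m)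
    (hq : q < 2 * m) :
    smallTuran r (2 * m - i) + i * (q + i) ≤ smallTuran r (2 * m) + smallTuran r q := by
  have h1 := two_mul_smallTuran_cases (r := r) (j := 2 * m - i) (by omega)
  have h2 := two_mul_smallTuran_cases (r := r) (j := 2 * m) (by omega)
  have h3 := two_mul_smallTuran_cases (r := r) (j := q) (by omega)
  rw [Nat.cast_sub (by omega)] at h1
  push_cast at h1 h2
  zify at hmr hrm hi hq ⊢
  have h4 : (0 : ℤ) ≤ i * (m - 1 - i) := mul_nonneg (by positivity) (by linarith)
  have h5 : (0 : ℤ) ≤ (q - i) * (q - i - 1) := by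
    rcases le_or_gt (q : ℤ) i with h | h
    · nlinarith
    · exact mul_nonneg (by linarith) (by linarith)
  rcases h2 with ⟨h2, h2'⟩ | ⟨h2, h2'⟩
  · linarith
  rcases h3 with ⟨h3, h3'⟩ | ⟨h3, h3'⟩
  · rcases h1 with ⟨h1, h1'⟩ | ⟨h1, h1'⟩ <;> nlinarith
  · have h6 : (0 : ℤ) ≤ (q - i - 2) * (q - i - 1) := mul_nonneg (by linarith) (by linarith)
    rcases h1 with ⟨h1, h1'⟩ | ⟨h1, h1'⟩ <;> nlinarith

theorem smallTuran_add_mul_le_blockTuran {m r i n : ℕ} (hmr : m ≤ r) (hrm : r < 2 * m)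
    (hi : i + 1 ≤ m) (hn : 2 * m ≤ n) :
    smallTuran r (2 * m - i) + i * (n - (2 * m - i)) ≤ blockTuran m r n := by
  have hm : 0 < 2 * m := by omega
  have h1 := smallTuran_add_mul_le hmr hrm hi (Nat.mod_lt n hm)
  have h2 : 2 * m * i ≤ smallTuran r (2 * m) := by
    have h2 := two_mul_smallTuran_cases (r := r) (j := 2 * m) (by omega)
    push_cast at h2
    zify at hmr hrm hi ⊢
    rcases h2 with ⟨h2, h2'⟩ | ⟨h2, h2'⟩ <;> nlinarith
  obtain ⟨p, hp⟩ : ∃ p, n / (2 * m) = p + 1 :=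
    Nat.exists_eq_add_of_lt (Nat.div_pos hn hm) |>.imp fun p hp => by omega
  have h3 := Nat.div_add_mod n (2 * m)
  unfold blockTuran
  rw [hp] at h3 ⊢
  have h4 : n - (2 * m - i) = 2 * m * p + (n % (2 * m) + i) := by
    rw [mul_add] at h3
    omega
  rw [h4]
  nlinarith [Nat.mul_le_mul_left p h2]

open Classical in
/-- Twice the number of edges of `G` inside `S`. -/
noncomputable def SimpleGraph.dartCount {V : Type*} (G : SimpleGraph V) (S : Finset V) : ℕ :=
  ∑ v ∈ S, ∑ w ∈ S, if G.Adj v w then 1 else 0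

open Classical in
theorem SimpleGraph.dartCount_insert {V : Type*} [DecidableEq V] (G : SimpleGraph V) {S : Finset V}
    {v : V} (hv : v ∉ S) :
    G.dartCount (insert v S) = G.dartCount S + 2 * (S.filter (G.Adj v)).card := by
  unfold dartCount
  simp_rw [Finset.sum_insert hv, Finset.sum_add_distrib, Finset.card_filter]
  simp only [G.loopless.irrefl, if_false, G.adj_comm _ v]
  ring

theorem SimpleGraph.dartCount_univ {V : Type*} [Fintype V] (G : SimpleGraph V) :
    G.dartCount Finset.univ = 2 * G.edgeSet.ncard := by
  classical
  rw [← coe_edgeFinset, Set.ncard_coe_finset, ← sum_degrees_eq_twice_card_edges]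
  refine Finset.sum_congr rfl fun v _ => ?_
  rw [← card_neighborFinset_eq_degree, neighborFinset_eq_filter, Finset.card_filter]

theorem SimpleGraph.dartCount_union {V : Type*} [DecidableEq V] (G : SimpleGraph V)
    {S T : Finset V} (hST : Disjoint S T) (h : ∀ u ∈ S, ∀ v ∈ T, ¬ G.Adj u v) :
    G.dartCount (S ∪ T) = G.dartCount S + G.dartCount T := by
  classical
  unfold dartCount
  rw [Finset.sum_union hST]
  congr 1
  · refine Finset.sum_congr rfl fun u hu => ?_
    rw [Finset.sum_union hST, Nat.add_eq_left]
    exact Finset.sum_eq_zero fun v hv => if_neg (h u hu v hv)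
  · refine Finset.sum_congr rfl fun v hv => ?_
    rw [Finset.sum_union hST, Nat.add_eq_right]
    exact Finset.sum_eq_zero fun u hu => if_neg fun h' => h u hu v hv h'.symm

theorem SimpleGraph.dartCount_comap_subtype {V : Type*} (G : SimpleGraph V) (S : Finset V) :
    (G.comap (Subtype.val : S → V)).dartCount Finset.univ = G.dartCount S := by
  classical
  unfold dartCount
  simp only [comap_adj]
  rw [← Finset.sum_coe_sort S]
  refine Finset.sum_congr rfl fun v _ => ?_
  rw [← Finset.sum_coe_sort S]

theorem SimpleGraph.CliqueFree.dartCount_add_le {V : Type*} {G : SimpleGraph V} {r : ℕ}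
    (hG : G.CliqueFree (r + 1)) (S : Finset V) :
    G.dartCount S + 2 * (S.card - r) ≤ S.card * (S.card - 1) := by
  classical
  induction S using Finset.strongInduction with
  | H S ih =>
  have hins : ∀ u ∈ S, G.dartCount S =
      G.dartCount (S.erase u) + 2 * ((S.erase u).filter (G.Adj u)).card := fun u hu => by
    rw [← dartCount_insert G (Finset.notMem_erase u S), Finset.insert_erase hu]
  rcases Nat.lt_or_ge r S.card with h | h
  · obtain ⟨u, hu, v, hv, huv, hadj⟩ : ∃ u ∈ S, ∃ v ∈ S, u ≠ v ∧ ¬ G.Adj u v := by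
      by_contra! hcl
      obtain ⟨T, hTS, hT⟩ := Finset.exists_subset_card_eq (show r + 1 ≤ S.card from h)
      exact hG T ⟨fun a ha b hb hab => hcl a (hTS ha) b (hTS hb) hab, hT⟩
    have h1 := ih _ (Finset.erase_ssubset hu)
    have h2 : ((S.erase u).filter (G.Adj u)).card ≤ ((S.erase u).erase v).card := by
      refine Finset.card_le_card fun w hw => ?_
      rw [Finset.mem_filter] at hw
      exact Finset.mem_erase.2 ⟨fun h => hadj (h ▸ hw.2), hw.1⟩
    rw [Finset.card_erase_of_mem (Finset.mem_erase.2 ⟨huv.symm, hv⟩)] at h2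
    rw [hins u hu]
    rw [Finset.card_erase_of_mem hu] at h1 h2
    have h3 : 2 ≤ S.card := Finset.one_lt_card.2 ⟨u, hu, v, hv, huv⟩
    obtain ⟨j, hj⟩ := Nat.exists_eq_add_of_le h3
    rw [hj] at h h1 h2 ⊢
    simp only [show 2 + j - 1 = j + 1 by omega, show j + 1 - 1 = j by omega] at h1 h2 ⊢
    have : (2 + j) * (j + 1) = (j + 1) * j + 2 * (j + 1) := by ring
    omega
  · rcases S.eq_empty_or_nonempty with rfl | ⟨u, hu⟩
    · simp [dartCount]
    have h1 := ih _ (Finset.erase_ssubset hu)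
    have h2 := Finset.card_filter_le (S.erase u) (G.Adj u)
    rw [hins u hu]
    rw [Finset.card_erase_of_mem hu] at h1 h2
    obtain ⟨j, hj⟩ := Nat.exists_eq_add_of_le (show 1 ≤ S.card from Finset.card_pos.2 ⟨u, hu⟩)
    rw [hj] at h h1 h2 ⊢
    simp only [show 1 + j - 1 = j by omega] at h1 h2 ⊢
    rcases j with _ | j
    · omega
    · simp only [show j + 1 - 1 = j by omega] at h1
      have : (1 + (j + 1)) * (j + 1) = (j + 1) * j + 2 * (j + 1) := by ring
      omega

theorem SimpleGraph.CliqueFree.dartCount_le {V : Type*} {G : SimpleGraph V} {r : ℕ}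
    (hG : G.CliqueFree (r + 1)) {S : Finset V} (hS : S.card ≤ 2 * r) :
    G.dartCount S ≤ 2 * smallTuran r S.card := by
  have := hG.dartCount_add_le S
  have := two_mul_smallTuran hS
  omega

open Classical in
/-- A graph whose cores of minimum degree `i + 1` are small has few edges. -/
theorem SimpleGraph.dartCount_le_of_core {V : Type*} {G : SimpleGraph V} {i c e : ℕ}
    (hcore : ∀ S : Finset V, (∀ v ∈ S, i + 1 ≤ (S.filter (G.Adj v)).card) → S.card ≤ c)
    (hsmall : ∀ S : Finset V, S.card = c → G.dartCount S ≤ e) (S : Finset V) (hS : c ≤ S.card) :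
    G.dartCount S ≤ e + 2 * (i * (S.card - c)) := by
  induction S using Finset.strongInduction with
  | H S ih =>
  rcases hS.eq_or_lt with h | h
  · exact (hsmall S h.symm).trans (Nat.le_add_right _ _)
  · obtain ⟨v, hv, hdeg⟩ : ∃ v ∈ S, (S.filter (G.Adj v)).card < i + 1 := by
      by_contra! hcon
      have := hcore S hcon
      omega
    have h1 := ih _ (Finset.erase_ssubset hv) (by rw [Finset.card_erase_of_mem hv]; omega)
    have h2 := Finset.card_le_card (Finset.filter_subset_filter (G.Adj v) (Finset.erase_subset v S))
    have h3 := dartCount_insert G (Finset.notMem_erase v S)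
    rw [Finset.insert_erase hv] at h3
    rw [Finset.card_erase_of_mem hv] at h1
    obtain ⟨d, hd⟩ : ∃ d, S.card - c = d + 1 := ⟨S.card - c - 1, by omega⟩
    rw [show S.card - 1 - c = d by omega] at h1
    rw [hd, mul_add]
    omega

theorem SimpleGraph.Connected.dartCount_le {V : Type*} [Fintype V] {G : SimpleGraph V}
    (hG : G.Connected) {m r : ℕ} (hmr : m ≤ r) (hrm : r < 2 * m) (hC : G.CliqueFree (r + 1))
    (hP : PathBounded (2 * m) G) (hV : 2 * m ≤ Fintype.card V) :
    G.dartCount Finset.univ ≤ 2 * blockTuran m r (Fintype.card V) := by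
  classical
  obtain ⟨i, hi, hcore⟩ := hG.exists_core_card_le (m := m) (by omega) hP
  have h1 := dartCount_le_of_core (G := G) (i := i) (c := 2 * m - i)
    (e := 2 * smallTuran r (2 * m - i)) (fun S hS => by
      have := hcore S (by convert! hS)
      omega) (fun S hS => by
      have := hC.dartCount_le (S := S) (by omega)
      rwa [hS] at this) Finset.univ (by rw [Finset.card_univ]; omega)
  have h2 := smallTuran_add_mul_le_blockTuran hmr hrm hi hV
  rw [Finset.card_univ] at h1
  omega

theorem SimpleGraph.PathBounded.comap {V W : Type*} {G : SimpleGraph V} {M : ℕ}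
    (hG : PathBounded M G) {f : W → V} (hf : Function.Injective f) :
    PathBounded M (G.comap f) := by
  intro l hl hn
  have := hG (l.map f) ((List.isChain_map f).2 hl) (hn.map hf)
  simpa using this

theorem SimpleGraph.dartCount_le_blockTuran {V : Type*} {G : SimpleGraph V} {m r : ℕ}
    (hmr : m ≤ r) (hrm : r < 2 * m) (hC : G.CliqueFree (r + 1)) (hP : PathBounded (2 * m) G)
    (S : Finset V) : G.dartCount S ≤ 2 * blockTuran m r S.card := by
  classical
  induction S using Finset.strongInduction with
  | H S ih =>
  rcases Nat.lt_or_ge S.card (2 * m) with h | h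
  · rw [blockTuran_eq_smallTuran (by omega) h.le]
    exact hC.dartCount_le (by omega)
  set H := G.comap (Subtype.val : S → V) with hH
  by_cases hconn : H.Connected
  · have hCH : H.CliqueFree (r + 1) :=
      hC.comap ⟨(Embedding.comap (Function.Embedding.subtype _) G).toCopy⟩
    have := hconn.dartCount_le hmr hrm hCH (hP.comap Subtype.val_injective) (by simpa using h)
    rw [hH, dartCount_comap_subtype] at this
    simpa using this
  · obtain ⟨w, hw⟩ : S.Nonempty := Finset.card_pos.1 (by omega)
    have : Nonempty S := ⟨⟨w, hw⟩⟩
    rw [connected_iff, not_and_or] at hconn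
    have hpre := hconn.resolve_right (not_not.2 this)
    unfold Preconnected at hpre
    push Not at hpre
    obtain ⟨u, v, huv⟩ := hpre
    set T := S.filter fun a => ∃ h : a ∈ S, H.Reachable u ⟨a, h⟩ with hT
    have hTS : T ⊆ S := Finset.filter_subset _ _
    have hu : u.1 ∈ T := Finset.mem_filter.2 ⟨u.2, u.2, Reachable.refl _⟩
    have hv : v.1 ∉ T := fun h => huv (Finset.mem_filter.1 h).2.2
    have h1 := ih T (Finset.ssubset_iff_subset_ne.2 ⟨hTS, fun h =>
      hv ((Finset.ext_iff.1 h v.1).2 v.2)⟩)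
    have h2 := ih (S \ T) (Finset.ssubset_iff_subset_ne.2 ⟨Finset.sdiff_subset, fun h =>
      (Finset.mem_sdiff.1 ((Finset.ext_iff.1 h u.1).2 u.2)).2 hu⟩)
    have h3 := dartCount_union G (S := T) (T := S \ T) Finset.disjoint_sdiff fun a ha b hb hab => by
      rw [Finset.mem_sdiff] at hb
      obtain ⟨haS, h4⟩ := (Finset.mem_filter.1 ha).2
      refine hb.2 (Finset.mem_filter.2 ⟨hb.1, hb.1, h4.trans (Adj.reachable ?_)⟩)
      exact hab
    rw [Finset.union_sdiff_of_subset hTS] at h3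
    have h4 := blockTuran_add_le hmr hrm T.card (S \ T).card
    rw [add_comm T.card, Finset.card_sdiff_add_card_eq_card hTS] at h4
    omega

/-- The graph on `ℕ` whose components are copies of `T(N, r)` on consecutive blocks. -/
def blockGraph (N r : ℕ) : SimpleGraph ℕ where
  Adj u v := u / N = v / N ∧ u % N % r ≠ v % N % r
  symm := ⟨fun _ _ h => ⟨h.1.symm, h.2.symm⟩⟩
  loopless := ⟨fun _ h => h.2 rfl⟩

theorem cliqueFree_blockGraph {N r : ℕ} (hr : 0 < r) : (blockGraph N r).CliqueFree (r + 1) := by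
  rintro s ⟨hs, hcard⟩
  have h1 : s.card ≤ (Finset.range r).card :=
    Finset.card_le_card_of_injOn (fun u => u % N % r)
      (fun u _ => Finset.mem_coe.2 (Finset.mem_range.2 (Nat.mod_lt _ hr)))
      fun u hu v hv huv => by
        by_contra hne
        exact (hs hu hv hne).2 huv
  rw [Finset.card_range] at h1
  omega

theorem pathBounded_blockGraph {N r : ℕ} (hN : 0 < N) : PathBounded N (blockGraph N r) := by
  intro l hl hn
  rcases l with _ | ⟨a, l⟩
  · simp
  have hblock : ∀ v ∈ a :: l, v / N = a / N := by
    have h2 : List.IsChain (fun u v => u / N = v / N) (a :: l) := hl.imp fun _ _ h => h.1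
    have : IsTrans ℕ fun u v => u / N = v / N := ⟨fun _ _ _ h h' => h.trans h'⟩
    intro v hv
    rcases List.mem_cons.1 hv with rfl | hv
    · rfl
    · exact ((List.pairwise_cons.1 (List.isChain_iff_pairwise.1 h2)).1 v hv).symm
  have hmap : ((a :: l).map (· % N)).Nodup := by
    refine List.Nodup.map_on (fun u hu v hv huv => ?_) hn
    rw [← Nat.div_add_mod u N, ← Nat.div_add_mod v N, hblock u hu, hblock v hv, huv]
  have h3 := (List.subperm_of_subset (l₂ := List.range N) hmap fun x hx => by
    obtain ⟨u, -, rfl⟩ := List.mem_map.1 hx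
    exact List.mem_range.2 (Nat.mod_lt _ hN)).length_le
  simpa using h3

open Classical in
theorem card_filter_blockGraph {m r : ℕ} (hmr : m ≤ r) (hrm : r < 2 * m) (n : ℕ) :
    ((Finset.range n).filter ((blockGraph (2 * m) r).Adj n)).card + (n % (2 * m) + 1 - r) =
      n % (2 * m) + (n % (2 * m) - r) := by
  have hN : 0 < 2 * m := by omega
  have hN2 : 2 * m ≤ 2 * r := by omega
  clear hmr
  generalize 2 * m = N at *
  have hq := Nat.mod_lt n hN
  have hn := Nat.div_add_mod n N
  have h1 : (Finset.range n).filter ((blockGraph N r).Adj n) =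
      ((Finset.range (n % N)).filter fun j => n % N % r ≠ j % r).map
        (addLeftEmbedding (N * (n / N))) := by
    ext v
    simp only [Finset.mem_filter, Finset.mem_range, Finset.mem_map, addLeftEmbedding_apply]
    constructor
    · rintro ⟨hv, hb, hne⟩
      have hv' := Nat.div_add_mod v N
      rw [← hb] at hv'
      exact ⟨v % N, ⟨by omega, hne⟩, hv'⟩
    · rintro ⟨j, ⟨hj, hne⟩, rfl⟩
      have hjN : j < N := by omega
      refine ⟨by omega, ?_, ?_⟩
      · rw [Nat.mul_add_div hN, Nat.div_eq_of_lt hjN, add_zero]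
      · rwa [Nat.mul_add_mod, Nat.mod_eq_of_lt hjN]
  rw [h1, Finset.card_map]
  generalize n % N = q at *
  rcases Nat.lt_or_ge q r with h | h
  · rw [Finset.filter_true_of_mem, Finset.card_range]
    · omega
    · intro j hj
      rw [Finset.mem_range] at hj
      rw [Nat.mod_eq_of_lt h, Nat.mod_eq_of_lt (hj.trans h)]
      exact hj.ne'
  · have h2 : ((Finset.range q).filter fun j => q % r ≠ j % r) = (Finset.range q).erase (q - r) := by
      ext j
      rw [Finset.mem_filter, Finset.mem_erase, Finset.mem_range, and_comm,
        Nat.mod_eq_sub_mod h, Nat.mod_eq_of_lt (a := q - r) (by omega)]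
      refine and_congr_left fun hj => not_congr ?_
      rcases Nat.lt_or_ge j r with h3 | h3
      · rw [Nat.mod_eq_of_lt h3, eq_comm]
      · rw [Nat.mod_eq_sub_mod h3, Nat.mod_eq_of_lt (by omega)]
        omega
    rw [h2, Finset.card_erase_of_mem (by rw [Finset.mem_range]; omega), Finset.card_range]
    omega

theorem dartCount_blockGraph {m r : ℕ} (hmr : m ≤ r) (hrm : r < 2 * m) (n : ℕ) :
    (blockGraph (2 * m) r).dartCount (Finset.range n) = 2 * blockTuran m r n := by
  classical
  induction n with
  | zero => simp [blockTuran, dartCount, smallTuran]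
  | succ n ih =>
  rw [Finset.range_add_one, dartCount_insert _ (by simp), ih]
  have h1 := card_filter_blockGraph hmr hrm n
  have hm : 0 < 2 * m := by omega
  have hq := Nat.mod_lt n hm
  have h2 : smallTuran r (n % (2 * m)) +
      ((Finset.range n).filter ((blockGraph (2 * m) r).Adj n)).card =
      smallTuran r (n % (2 * m) + 1) := by
    have h3 := two_mul_smallTuran (r := r) (j := n % (2 * m)) (by omega)
    have h4 := two_mul_smallTuran (r := r) (j := n % (2 * m) + 1) (by omega)
    have h5 : (n % (2 * m) + 1) * (n % (2 * m) + 1 - 1) =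
        n % (2 * m) * (n % (2 * m) - 1) + 2 * (n % (2 * m)) := by
      rcases n % (2 * m) with _ | j
      · rfl
      · simp only [Nat.add_sub_cancel]; ring
    omega
  have h3 : blockTuran m r (n + 1) =
      n / (2 * m) * smallTuran r (2 * m) + smallTuran r (n % (2 * m) + 1) := by
    rcases Nat.lt_or_ge (n % (2 * m) + 1) (2 * m) with h | h
    · have h4 : n + 1 = (n % (2 * m) + 1) + 2 * m * (n / (2 * m)) := by
        have := Nat.div_add_mod n (2 * m); omega
      rw [blockTuran, h4, Nat.add_mul_div_left _ _ hm, Nat.add_mul_mod_self_left,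
        Nat.div_eq_of_lt h, Nat.mod_eq_of_lt h, zero_add]
    · have h5 : n % (2 * m) + 1 = 2 * m := by omega
      have h4 : n + 1 = 2 * m * (n / (2 * m) + 1) := by
        have := Nat.div_add_mod n (2 * m); rw [mul_add]; omega
      rw [h5, h4, blockTuran, Nat.mul_div_cancel_left _ hm, Nat.mul_mod_right]
      simp [smallTuran]
      ring
  rw [h3, ← h2, blockTuran]
  ring

theorem dartCount_comap_val {G : SimpleGraph ℕ} (n : ℕ) :
    (G.comap (Fin.val : Fin n → ℕ)).dartCount Finset.univ = G.dartCount (Finset.range n) := by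
  classical
  unfold dartCount
  simp only [comap_adj]
  rw [Finset.sum_range]
  refine Finset.sum_congr rfl fun v _ => ?_
  rw [Finset.sum_range]

theorem SimpleGraph.CliqueFree.comap_val {G : SimpleGraph ℕ} {r : ℕ} (hG : G.CliqueFree r)
    (n : ℕ) : (G.comap (Fin.val : Fin n → ℕ)).CliqueFree r :=
  hG.comap ⟨(Embedding.comap Fin.valEmbedding G).toCopy⟩

theorem ncard_edgeSet_blockGraph {m r : ℕ} (hmr : m ≤ r) (hrm : r < 2 * m) (n : ℕ) :
    ((blockGraph (2 * m) r).comap (Fin.val : Fin n → ℕ)).edgeSet.ncard = blockTuran m r n := by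
  have h1 := dartCount_univ ((blockGraph (2 * m) r).comap (Fin.val : Fin n → ℕ))
  rw [dartCount_comap_val, dartCount_blockGraph hmr hrm] at h1
  omega

theorem exK_eq_smallTuran {m r j : ℕ} (hmr : m ≤ r) (hrm : r < 2 * m) (hj : j ≤ 2 * m) :
    exK j (r + 1) = smallTuran r j := by
  refine IsGreatest.csSup_eq
    ⟨⟨_, (cliqueFree_blockGraph (N := 2 * m) (by omega)).comap_val j, ?_⟩, ?_⟩
  · rw [ncard_edgeSet_blockGraph hmr hrm, blockTuran_eq_smallTuran (by omega) hj]
  · rintro e ⟨G, hG, rfl⟩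
    have h1 := hG.dartCount_le (S := Finset.univ) (by simp; omega)
    rw [dartCount_univ, Finset.card_univ, Fintype.card_fin] at h1
    omega

theorem pathBounded_iff_isPath {V : Type*} {G : SimpleGraph V} {N : ℕ} :
    PathBounded N G ↔ ∀ (u v : V) (W : G.Walk u v), W.IsPath → W.length < N := by
  constructor
  · intro h u v W hW
    have := h W.support W.isChain_adj_support hW.support_nodup
    rw [Walk.length_support] at this
    omega
  · intro h l hl hn
    rcases eq_or_ne l [] with rfl | hne
    · simp
    have := h _ _ (Walk.ofSupport l hne hl) (Walk.IsPath.mk' (by rwa [Walk.support_ofSupport]))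
    rw [Walk.length_ofSupport] at this
    omega

theorem stmt_18 (n k r p q : ℕ) (hko : Odd k) (hk : 3 ≤ k)
    (hr1 : k / 2 + 1 ≤ r) (hr2 : r < k) (hkn : k ≤ n)
    (hd : n = p * (k - 1) + q) (hq : q ≤ k - 2) :
    IsGreatest {m | ∃ G : SimpleGraph (Fin n), G.CliqueFree r ∧
        (∀ (u v : Fin n) (W : G.Walk u v), W.IsPath → W.length < k - 1) ∧
        G.edgeSet.ncard = m}
      (p * exK (k - 1) r + exK q r) := by
  obtain ⟨m, rfl⟩ := hko
  obtain ⟨r, rfl⟩ : ∃ s, r = s + 1 := ⟨r - 1, by omega⟩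
  have hmr : m ≤ r := by omega
  have hrm : r < 2 * m := by omega
  have hm : 0 < 2 * m := by omega
  have hval : p * exK (2 * m) (r + 1) + exK q (r + 1) = blockTuran m r n := by
    rw [exK_eq_smallTuran hmr hrm le_rfl, exK_eq_smallTuran hmr hrm (by omega), blockTuran, hd,
      Nat.add_sub_cancel, mul_comm p (2 * m), Nat.mul_add_div hm, Nat.mul_add_mod,
      Nat.div_eq_of_lt (by omega), Nat.mod_eq_of_lt (by omega), add_zero]
  simp_rw [Nat.add_sub_cancel, ← pathBounded_iff_isPath]
  rw [hval]
  refine ⟨⟨_, (cliqueFree_blockGraph (by omega)).comap_val n,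
    (pathBounded_blockGraph hm).comap Fin.val_injective, ncard_edgeSet_blockGraph hmr hrm n⟩, ?_⟩
  rintro e ⟨G, hG, hP, rfl⟩
  have h1 := dartCount_le_blockTuran hmr hrm hG hP Finset.univ
  rw [dartCount_univ, Finset.card_univ, Fintype.card_fin] at h1
  omega
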